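/- The ℚ-vector space MPV(2,25) spanned by all multiple polylogarithm values of weight 2 at 25th roots of unity has dimension at most 116, i.e., d(2,25) ≤ 116. -/

import Mathlib

open Filter Topology

/-- `mpvPartial l m` is the finite iterated sum
`∑_{m > k₁ > k₂ > ⋯ > kₙ > 0} ∏ⱼ ζⱼ^{kⱼ} / kⱼ^{sⱼ}`, where `l = [(s₁,ζ₁),…,(sₙ,ζₙ)]`,
i.e. the partial sum (in the outermost variable `k₁`) of the multiple
polylogarithm series; the inner sums are finite. -/
noncomputable def mpvPartial : List (ℕ × ℂ) → ℕ → ℂ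
  | [], _ => 1
  | (s, z) :: t, m => ∑ k ∈ Finset.Ico 1 m, z ^ k / (k : ℂ) ^ s * mpvPartial t k

/-- The multiple polylogarithm value
`Li_{s₁,…,sₙ}(ζ₁,…,ζₙ) = ∑_{k₁>⋯>kₙ>0} ζ₁^{k₁}⋯ζₙ^{kₙ} / (k₁^{s₁}⋯kₙ^{sₙ})`,
encoded by the list `l = [(s₁,ζ₁),…,(sₙ,ζₙ)]`: the limit of the sequence of
partial sums in the outermost summation variable. -/
noncomputable def Li (l : List (ℕ × ℂ)) : ℂ :=
  limUnder atTop (mpvPartial l)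

/-- The set of all multiple polylogarithm values of weight `w` and level `N`:
values `Li_{s₁,…,sₙ}(ζ₁,…,ζₙ)` with all `sⱼ ≥ 1`, all `ζⱼ` being `N`-th roots of
unity, total weight `s₁+⋯+sₙ = w`, and `(s₁,ζ₁) ≠ (1,1)`. -/
def MPVset (w N : ℕ) : Set ℂ :=
  {x | ∃ l : List (ℕ × ℂ),
    (∀ q ∈ l, 0 < q.1 ∧ q.2 ^ N = 1) ∧
    (l.map Prod.fst).sum = w ∧
    l.head? ≠ some (1, 1) ∧
    x = Li l}

/-- `MPV w N` is the `ℚ`-vector subspace of `ℂ` spanned by all multiple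
polylogarithm values of weight `w` and level `N`. -/
noncomputable def MPV (w N : ℕ) : Submodule ℚ ℂ :=
  Submodule.span ℚ (MPVset w N)

open Finset

theorem mpvPartial_singleton (s : ℕ) (x : ℂ) (m : ℕ) :
    mpvPartial [(s, x)] m = ∑ k ∈ Ico 1 m, x ^ k / (k : ℂ) ^ s := by
  simp [mpvPartial]

theorem mpvPartial_one_one (x y : ℂ) (m : ℕ) :
    mpvPartial [(1, x), (1, y)] m =
      ∑ k ∈ Ico 1 m, x ^ k / (k : ℂ) * ∑ j ∈ Ico 1 k, y ^ j / (j : ℂ) := by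
  simp [mpvPartial]

theorem tendsto_Li {l : List (ℕ × ℂ)} {L : ℂ} (h : Tendsto (mpvPartial l) atTop (𝓝 L)) :
    Tendsto (mpvPartial l) atTop (𝓝 (Li l)) :=
  tendsto_nhds_limUnder ⟨L, h⟩

section Convergence

variable {x y : ℂ}

/-- Explicit bound for a segment of the series `∑ xᵏ / k` on the unit circle. -/
theorem norm_one_sub_mul_sum_Ico_le (hx : ‖x‖ = 1) {p q : ℕ} (hp : 1 ≤ p) (hpq : p ≤ q) :
    ‖(1 - x) * ∑ k ∈ Ico p q, x ^ k / (k : ℂ)‖ ≤ 2 / p := by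
  have key : ∀ q, p ≤ q → ‖(1 - x) * ∑ k ∈ Ico p q, x ^ k / (k : ℂ) - (x ^ p / p - x ^ q / q)‖
      ≤ 1 / p - 1 / q := by
    intro q hq
    induction q, hq using Nat.le_induction with
    | base => simp
    | succ q hq ih =>
      have hq0 : (0 : ℝ) < q := by exact_mod_cast (by omega : 0 < q)
      have hqc : (q : ℂ) ≠ 0 := by exact_mod_cast hq0.ne'
      have hqc' : (q : ℂ) + 1 ≠ 0 := by exact_mod_cast (by omega : q + 1 ≠ 0)
      rw [sum_Ico_succ_top hq]
      have e : (1 - x) * (∑ k ∈ Ico p q, x ^ k / (k : ℂ) + x ^ q / q) -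
            (x ^ p / p - x ^ (q + 1) / ((q + 1 : ℕ) : ℂ)) =
          ((1 - x) * ∑ k ∈ Ico p q, x ^ k / (k : ℂ) - (x ^ p / p - x ^ q / q)) +
            x ^ (q + 1) * (((1 / ((q : ℝ) + 1) - 1 / q : ℝ)) : ℂ) := by
        push_cast
        field_simp
        ring
      rw [e]
      refine (norm_add_le _ _).trans ?_
      rw [norm_mul, norm_pow, hx, one_pow, one_mul, Complex.norm_real, Real.norm_eq_abs,
        abs_of_nonpos (by
          rw [sub_nonpos]; exact one_div_le_one_div_of_le hq0 (by linarith))]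
      push_cast
      linarith
  have h := key q hpq
  have h2 : ‖x ^ p / (p : ℂ) - x ^ q / q‖ ≤ 1 / p + 1 / q := by
    refine (norm_sub_le _ _).trans ?_
    simp [hx]
  have h3 := norm_sub_norm_le ((1 - x) * ∑ k ∈ Ico p q, x ^ k / (k : ℂ)) (x ^ p / p - x ^ q / q)
  have h4 : (2 : ℝ) / p = 1 / p + 1 / p := by ring
  linarith

/-- The tails of `∑ xᵏ / k` are `O(1 / p)` on the unit circle away from `1`. -/
theorem exists_norm_sum_Ico_le (hx : ‖x‖ = 1) (hx1 : x ≠ 1) :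
    ∃ C : ℝ, 0 ≤ C ∧ ∀ p q : ℕ, 1 ≤ p → p ≤ q →
      ‖∑ k ∈ Ico p q, x ^ k / (k : ℂ)‖ ≤ C / p := by
  have h0 : 0 < ‖1 - x‖ := norm_pos_iff.2 (sub_ne_zero.2 hx1.symm)
  refine ⟨2 / ‖1 - x‖, by positivity, fun p q hp hpq => ?_⟩
  have h := norm_one_sub_mul_sum_Ico_le hx hp hpq
  rw [norm_mul] at h
  rw [div_right_comm, le_div_iff₀ h0]
  linarith

theorem tendsto_Li_one (hx : ‖x‖ = 1) (hx1 : x ≠ 1) :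
    Tendsto (mpvPartial [(1, x)]) atTop (𝓝 (Li [(1, x)])) := by
  obtain ⟨C, -, hC⟩ := exists_norm_sum_Ico_le hx hx1
  have hc : CauchySeq fun n => mpvPartial [(1, x)] (n + 1) := by
    refine cauchySeq_of_le_tendsto_0' (fun n : ℕ => C / ((n + 1 : ℕ) : ℝ)) (fun n m hnm => ?_)
      ((tendsto_add_atTop_iff_nat 1).2 (tendsto_const_div_atTop_nhds_zero_nat C))
    rw [dist_comm, dist_eq_norm, mpvPartial_singleton, mpvPartial_singleton,
      ← sum_Ico_consecutive _ (by omega : 1 ≤ n + 1) (by omega : n + 1 ≤ m + 1),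
      add_sub_cancel_left]
    simpa using hC (n + 1) (m + 1) (by omega) (by omega)
  obtain ⟨L, hL⟩ := cauchySeq_tendsto_of_complete hc
  exact tendsto_Li ((tendsto_add_atTop_iff_nat 1).1 hL)

theorem tendsto_Li_two (hx : ‖x‖ = 1) :
    Tendsto (mpvPartial [(2, x)]) atTop (𝓝 (Li [(2, x)])) := by
  have hs : Summable fun k : ℕ => x ^ k / (k : ℂ) ^ 2 := by
    refine Summable.of_norm ?_
    simp [hx]
  refine tendsto_Li (hs.hasSum.tendsto_sum_nat.congr fun m => ?_)
  rw [mpvPartial_singleton]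
  rcases Nat.eq_zero_or_pos m with rfl | hm
  · simp
  · rw [range_eq_Ico, sum_eq_sum_Ico_succ_bot hm]
    simp

theorem tendsto_harmonic_div :
    Tendsto (fun m : ℕ => (∑ k ∈ Ico 1 m, 1 / (k : ℝ)) / m) atTop (𝓝 0) := by
  refine (tendsto_one_div_atTop_nhds_zero_nat (𝕜 := ℝ)).cesaro.congr fun m => ?_
  rcases Nat.eq_zero_or_pos m with rfl | hm
  · simp
  · rw [range_eq_Ico, sum_eq_sum_Ico_succ_bot hm]
    simp [div_eq_inv_mul]

theorem norm_sum_Ico_le_harmonic (hy : ‖y‖ = 1) (m : ℕ) :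
    ‖∑ k ∈ Ico 1 m, y ^ k / (k : ℂ)‖ ≤ ∑ k ∈ Ico 1 m, 1 / (k : ℝ) := by
  refine (norm_sum_le _ _).trans (sum_le_sum fun k _ => ?_)
  simp [hy]

/-- Interchanging the order of summation in the double sum. -/
theorem mpvPartial_one_one_eq (x y : ℂ) (m : ℕ) :
    mpvPartial [(1, x), (1, y)] m =
      ∑ j ∈ Ico 1 m, y ^ j / (j : ℂ) * ∑ k ∈ Ico (j + 1) m, x ^ k / (k : ℂ) := by
  rw [mpvPartial_one_one]
  simp_rw [mul_sum]
  rw [sum_comm' (t' := Ico 1 m) (s' := fun j => Ico (j + 1) m)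
    (by intro a b; simp only [mem_Ico]; omega)]
  exact sum_congr rfl fun j _ => sum_congr rfl fun k _ => mul_comm _ _

theorem tendsto_Li_one_one (hx : ‖x‖ = 1) (hx1 : x ≠ 1) (hy : ‖y‖ = 1) :
    Tendsto (mpvPartial [(1, x), (1, y)]) atTop (𝓝 (Li [(1, x), (1, y)])) := by
  obtain ⟨C, hC0, hC⟩ := exists_norm_sum_Ico_le hx hx1
  have hA := tendsto_Li_one hx hx1
  set A := Li [(1, x)]
  have tail : ∀ p : ℕ, 1 ≤ p → ‖A - mpvPartial [(1, x)] p‖ ≤ C / p := by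
    intro p hp
    refine le_of_tendsto (hA.sub_const _).norm ?_
    filter_upwards [eventually_ge_atTop p] with q hq
    rw [mpvPartial_singleton, mpvPartial_singleton, ← sum_Ico_consecutive _ hp hq,
      add_sub_cancel_left]
    simpa using hC p q hp hq
  have hs : Summable fun j : ℕ => y ^ j / (j : ℂ) * (A - mpvPartial [(1, x)] (j + 1)) := by
    refine Summable.of_norm_bounded (g := fun j : ℕ => C * (1 / (j : ℝ) ^ 2))
      ((Real.summable_one_div_nat_pow.2 (by norm_num)).mul_left C) fun j => ?_
    rcases Nat.eq_zero_or_pos j with rfl | hj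
    · simp
    have hj' : (0 : ℝ) < j := by exact_mod_cast hj
    have h1 := tail (j + 1) (by omega)
    have h2 : C / ((j + 1 : ℕ) : ℝ) ≤ C / j :=
      div_le_div_of_nonneg_left hC0 hj' (by push_cast; linarith)
    rw [norm_mul, norm_div, norm_pow, hy, one_pow, Complex.norm_natCast]
    calc 1 / (j : ℝ) * ‖A - mpvPartial [(1, x)] (j + 1)‖ ≤ 1 / j * (C / j) := by gcongr; linarith
      _ = C * (1 / (j : ℝ) ^ 2) := by field_simp
  have hz : Tendsto (fun m : ℕ => (∑ j ∈ Ico 1 m, y ^ j / (j : ℂ)) *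
      (A - mpvPartial [(1, x)] m)) atTop (𝓝 0) := by
    refine squeeze_zero_norm' (a := fun m : ℕ => C * ((∑ k ∈ Ico 1 m, 1 / (k : ℝ)) / m)) ?_
      (by simpa using tendsto_harmonic_div.const_mul C)
    filter_upwards [eventually_ge_atTop 1] with m hm
    rw [norm_mul]
    calc _ ≤ (∑ k ∈ Ico 1 m, 1 / (k : ℝ)) * (C / m) :=
          mul_le_mul (norm_sum_Ico_le_harmonic hy m) (tail m hm) (norm_nonneg _)
            (sum_nonneg fun _ _ => by positivity)
      _ = _ := by ring
  refine tendsto_Li ((hs.hasSum.tendsto_sum_nat.sub hz).congr' ?_)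
  filter_upwards [eventually_ge_atTop 1] with m hm
  rw [mpvPartial_one_one_eq, range_eq_Ico, sum_eq_sum_Ico_succ_bot hm, sum_mul]
  simp only [CharP.cast_eq_zero, div_zero, zero_mul, zero_add]
  rw [← sum_sub_distrib]
  refine sum_congr rfl fun j hj => ?_
  rw [mem_Ico] at hj
  rw [← mul_sub, mpvPartial_singleton, mpvPartial_singleton,
    ← sum_Ico_consecutive _ (by omega : 1 ≤ j + 1) (by omega : j + 1 ≤ m)]
  simp only [pow_one]
  ring

theorem sum_Ico_one_reflect {M : Type*} [AddCommMonoid M] (f : ℕ → M) (m : ℕ) :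
    ∑ j ∈ Ico 1 m, f (m - j) = ∑ j ∈ Ico 1 m, f j := by
  rcases Nat.eq_zero_or_pos m with rfl | hm
  · simp
  · simpa using sum_Ico_reflect f 1 (Nat.le_succ m)

/-- The corner of the square omitted from the triangle `n + j < m` contributes nothing in the
limit. -/
theorem tendsto_corner (hx : ‖x‖ = 1) (hx1 : x ≠ 1) (hy : ‖y‖ = 1) :
    Tendsto (fun m : ℕ => ∑ j ∈ Ico 1 m, y ^ j / (j : ℂ) * ∑ n ∈ Ico (m - j) m, x ^ n / (n : ℂ))
      atTop (𝓝 0) := by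
  obtain ⟨C, hC0, hC⟩ := exists_norm_sum_Ico_le hx hx1
  refine squeeze_zero_norm
    (a := fun m : ℕ => (2 * C) * ((∑ k ∈ Ico 1 m, 1 / (k : ℝ)) / m)) (fun m => ?_)
    (by simpa using tendsto_harmonic_div.const_mul (2 * C))
  have hr := sum_Ico_one_reflect (fun j : ℕ => 1 / (j : ℝ)) m
  calc _ ≤ ∑ j ∈ Ico 1 m, C / m * (1 / (j : ℝ) + 1 / ((m - j : ℕ) : ℝ)) := by
        refine norm_sum_le_of_le _ fun j hj => ?_
        rw [mem_Ico] at hj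
        have hj0 : (0 : ℝ) < j := by exact_mod_cast hj.1
        have hjm : (0 : ℝ) < m - j := by rw [sub_pos]; exact_mod_cast hj.2
        have hm : (0 : ℝ) < m := by linarith
        have h := hC (m - j) m (by omega) (by omega)
        rw [norm_mul, norm_div, norm_pow, hy, one_pow, Complex.norm_natCast]
        calc _ ≤ 1 / (j : ℝ) * (C / ((m - j : ℕ) : ℝ)) := by gcongr
          _ = _ := by
            rw [Nat.cast_sub hj.2.le]
            field_simp
            ring
    _ = _ := by
        rw [← mul_sum, sum_add_distrib, hr]
        ring

/-- The finite form of the stuffle relation. -/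
theorem mpvPartial_stuffle (x y : ℂ) (m : ℕ) :
    mpvPartial [(1, x), (1, y)] m + mpvPartial [(1, y), (1, x)] m + mpvPartial [(2, x * y)] m =
      mpvPartial [(1, x)] m * mpvPartial [(1, y)] m := by
  simp only [mpvPartial_one_one, mpvPartial_singleton, pow_one]
  induction m with
  | zero => simp
  | succ m ih =>
    rcases Nat.eq_zero_or_pos m with rfl | hm
    · simp
    simp only [sum_Ico_succ_top hm]
    rw [mul_pow]
    linear_combination ih

/-- The finite form of the shuffle relation, over the triangle `n + j < m`. -/
theorem mpvPartial_shuffle (hx : x ≠ 0) (hy : y ≠ 0) (m : ℕ) :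
    mpvPartial [(1, x), (1, y / x)] m + mpvPartial [(1, y), (1, x / y)] m =
      ∑ j ∈ Ico 1 m, y ^ j / (j : ℂ) * ∑ n ∈ Ico 1 (m - j), x ^ n / (n : ℂ) := by
  simp only [mpvPartial_one_one]
  induction m with
  | zero => simp
  | succ m ih =>
    rcases Nat.eq_zero_or_pos m with rfl | hm
    · simp
    have hr : x ^ m / (m : ℂ) * ∑ j ∈ Ico 1 m, (y / x) ^ j / (j : ℂ) +
        y ^ m / (m : ℂ) * ∑ j ∈ Ico 1 m, (x / y) ^ j / (j : ℂ) =
        ∑ j ∈ Ico 1 m, y ^ j / (j : ℂ) * (x ^ (m - j) / ((m - j : ℕ) : ℂ)) := by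
      rw [← sum_Ico_one_reflect (fun j : ℕ => (x / y) ^ j / (j : ℂ)), mul_sum, mul_sum,
        ← sum_add_distrib]
      refine sum_congr rfl fun j hj => ?_
      rw [mem_Ico] at hj
      obtain ⟨n, rfl⟩ := Nat.exists_eq_add_of_lt hj.2
      have h1 : j + n + 1 - j = n + 1 := by omega
      have h2 : (j : ℂ) ≠ 0 := by exact_mod_cast (by omega : j ≠ 0)
      have h3 : (n : ℂ) + 1 ≠ 0 := by exact_mod_cast (by omega : n + 1 ≠ 0)
      have h4 : (j : ℂ) + n + 1 ≠ 0 := by exact_mod_cast (by omega : j + n + 1 ≠ 0)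
      rw [h1]
      push_cast
      rw [div_pow, div_pow, add_assoc, pow_add x, pow_add y]
      field_simp
      ring
    rw [sum_Ico_succ_top hm, sum_Ico_succ_top hm, sum_Ico_succ_top hm]
    have hs : ∑ j ∈ Ico 1 m, y ^ j / (j : ℂ) * ∑ n ∈ Ico 1 (m + 1 - j), x ^ n / (n : ℂ) =
        ∑ j ∈ Ico 1 m, y ^ j / (j : ℂ) * ∑ n ∈ Ico 1 (m - j), x ^ n / (n : ℂ) +
        ∑ j ∈ Ico 1 m, y ^ j / (j : ℂ) * (x ^ (m - j) / ((m - j : ℕ) : ℂ)) := by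
      rw [← sum_add_distrib]
      refine sum_congr rfl fun j hj => ?_
      rw [mem_Ico] at hj
      rw [Nat.sub_add_comm hj.2.le, sum_Ico_succ_top (by omega), mul_add]
    rw [hs, ← ih, ← hr]
    simp
    ring

/-- The shuffle relation holds asymptotically, also at `y = 1`. -/
theorem tendsto_shuffle (hx : ‖x‖ = 1) (hx1 : x ≠ 1) (hy : ‖y‖ = 1) :
    Tendsto (fun m => mpvPartial [(1, x)] m * mpvPartial [(1, y)] m -
      (mpvPartial [(1, x), (1, y / x)] m + mpvPartial [(1, y), (1, x / y)] m)) atTop (𝓝 0) := by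
  have hx0 : x ≠ 0 := by rintro rfl; simp at hx
  have hy0 : y ≠ 0 := by rintro rfl; simp at hy
  refine (tendsto_corner hx hx1 hy).congr fun m => ?_
  rw [mpvPartial_shuffle hx0 hy0, mul_comm, mpvPartial_singleton, mpvPartial_singleton, sum_mul,
    ← sum_sub_distrib]
  simp only [pow_one]
  refine sum_congr rfl fun j hj => ?_
  rw [mem_Ico] at hj
  rw [← sum_Ico_consecutive _ (by omega : 1 ≤ m - j) (by omega : m - j ≤ m)]
  ring

theorem Li_stuffle (hx : ‖x‖ = 1) (hx1 : x ≠ 1) (hy : ‖y‖ = 1) (hy1 : y ≠ 1) :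
    Li [(1, x), (1, y)] + Li [(1, y), (1, x)] + Li [(2, x * y)] = Li [(1, x)] * Li [(1, y)] :=
  tendsto_nhds_unique
    (((tendsto_Li_one_one hx hx1 hy).add (tendsto_Li_one_one hy hy1 hx)).add
      (tendsto_Li_two (by simp [hx, hy])))
    (((tendsto_Li_one hx hx1).mul (tendsto_Li_one hy hy1)).congr fun m =>
      (mpvPartial_stuffle x y m).symm)

theorem Li_shuffle (hx : ‖x‖ = 1) (hx1 : x ≠ 1) (hy : ‖y‖ = 1) (hy1 : y ≠ 1) :
    Li [(1, x), (1, y / x)] + Li [(1, y), (1, x / y)] = Li [(1, x)] * Li [(1, y)] := by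
  have h := tendsto_nhds_unique (tendsto_shuffle hx hx1 hy)
    (((tendsto_Li_one hx hx1).mul (tendsto_Li_one hy hy1)).sub
      ((tendsto_Li_one_one hx hx1 (y := y / x) (by simp [hx, hy])).add
        (tendsto_Li_one_one hy hy1 (y := x / y) (by simp [hx, hy]))))
  linear_combination h

/-- The regularized double shuffle relation. -/
theorem Li_one_one_inv (hx : ‖x‖ = 1) (hx1 : x ≠ 1) :
    Li [(1, x), (1, x⁻¹)] = Li [(1, x), (1, 1)] + Li [(2, x)] := by
  have h := tendsto_nhds_unique
    ((tendsto_shuffle hx hx1 norm_one).congr fun m => by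
      rw [← mpvPartial_stuffle, div_one, one_div, mul_one]
      show _ = mpvPartial [(1, x), (1, 1)] m + mpvPartial [(2, x)] m -
        mpvPartial [(1, x), (1, x⁻¹)] m
      ring)
    (((tendsto_Li_one_one hx hx1 norm_one).add (tendsto_Li_two hx)).sub
      (tendsto_Li_one_one hx hx1 (y := x⁻¹) (by simp [hx])))
  linear_combination h

end Convergence

section Values

variable {x : ℂ}

theorem exp_Li_one (hx : ‖x‖ = 1) (hx1 : x ≠ 1) : Complex.exp (Li [(1, x)]) = (1 - x)⁻¹ := by
  have hsum : Tendsto (fun n => ∑ i ∈ range n, x ^ i / (i : ℂ)) atTop (𝓝 (Li [(1, x)])) := by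
    refine (tendsto_Li_one hx hx1).congr fun m => ?_
    rw [mpvPartial_singleton]
    rcases Nat.eq_zero_or_pos m with rfl | hm
    · simp
    · rw [range_eq_Ico, sum_eq_sum_Ico_succ_bot hm]
      simp
  have habel := Complex.tendsto_tsum_powerSeries_nhdsWithin_lt hsum
  have hlim : Tendsto (fun r : ℝ => (1 - (r : ℂ) * x)⁻¹) (𝓝[<] 1) (𝓝 (1 - x)⁻¹) := by
    have hc : ContinuousAt (fun r : ℝ => (1 - (r : ℂ) * x)⁻¹) 1 := by
      refine ContinuousAt.inv₀ (by fun_prop) ?_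
      simpa [sub_eq_zero] using hx1.symm
    simpa using hc.tendsto.mono_left nhdsWithin_le_nhds
  refine tendsto_nhds_unique ?_ hlim
  have hexp := ((Complex.continuous_exp.tendsto _).comp habel)
  rw [tendsto_map'_iff] at hexp
  refine hexp.congr' ?_
  filter_upwards [Ioo_mem_nhdsLT (show (0 : ℝ) < 1 by norm_num)] with r hr
  have hn : ‖(r : ℂ) * x‖ < 1 := by
    rw [norm_mul, hx, mul_one, Complex.norm_real, Real.norm_eq_abs, abs_of_pos hr.1]
    exact hr.2
  have ht : ∑' n : ℕ, x ^ n / (n : ℂ) * (r : ℂ) ^ n = -Complex.log (1 - r * x) := by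
    rw [← (Complex.hasSum_taylorSeries_neg_log hn).tsum_eq]
    refine tsum_congr fun n => ?_
    rw [mul_pow]
    ring
  have h0 : 1 - (r : ℂ) * x ≠ 0 := fun h => by
    rw [sub_eq_zero] at h
    rw [← h] at hn
    simp at hn
  simp only [Function.comp_apply]
  rw [ht, Complex.exp_neg, Complex.exp_log h0]

/-- The distribution relation, for partial sums. -/
theorem mpvPartial_distribution {p : ℕ} (hp : 0 < p) {w : ℂ} (hw : IsPrimitiveRoot w p) (s : ℕ)
    (x : ℂ) (m : ℕ) :
    (p : ℂ) ^ s * ∑ i ∈ range p, mpvPartial [(s, x * w ^ i)] (p * m + 1) =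
      p * mpvPartial [(s, x ^ p)] (m + 1) := by
  have hsum : ∀ k : ℕ, ∑ i ∈ range p, (w ^ i) ^ k = if p ∣ k then (p : ℂ) else 0 := by
    intro k
    have e : ∀ i, (w ^ i) ^ k = (w ^ k) ^ i := fun i => by rw [← pow_mul, ← pow_mul, mul_comm]
    simp_rw [e]
    split_ifs with h
    · simp [(hw.pow_eq_one_iff_dvd k).2 h]
    · have h1 : w ^ k ≠ 1 := fun h1 => h ((hw.pow_eq_one_iff_dvd k).1 h1)
      rw [geom_sum_eq h1, ← pow_mul, mul_comm, pow_mul, hw.pow_eq_one]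
      simp
  have hp0 : (p : ℂ) ≠ 0 := by exact_mod_cast hp.ne'
  simp only [mpvPartial_singleton]
  rw [sum_comm]
  have e : ∀ k : ℕ, ∑ i ∈ range p, (x * w ^ i) ^ k / (k : ℂ) ^ s =
      if p ∣ k then p * (x ^ k / (k : ℂ) ^ s) else 0 := by
    intro k
    simp_rw [mul_pow, mul_div_right_comm]
    rw [← mul_sum, hsum]
    split_ifs
    · ring
    · simp
  simp_rw [e]
  rw [← sum_filter, mul_sum, mul_sum]
  refine (sum_bij' (i := fun k _ => p * k) (j := fun k _ => k / p) ?_ ?_ ?_ ?_ ?_).symm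
  · intro k hk
    simp only [mem_Ico, mem_filter] at hk ⊢
    exact ⟨⟨Nat.mul_pos hp hk.1, Nat.lt_succ_of_le (Nat.mul_le_mul_left _ (by omega))⟩,
      dvd_mul_right _ _⟩
  · intro k hk
    simp only [mem_Ico, mem_filter] at hk ⊢
    obtain ⟨⟨h1, h2⟩, n, rfl⟩ := hk
    rw [Nat.mul_div_cancel_left _ hp]
    exact ⟨Nat.pos_of_mul_pos_left h1, Nat.lt_succ_of_le (Nat.le_of_mul_le_mul_left (by omega) hp)⟩
  · intro k _
    exact Nat.mul_div_cancel_left _ hp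
  · intro k hk
    exact Nat.mul_div_cancel' (mem_filter.1 hk).2
  · intro k hk
    rw [mem_Ico] at hk
    have hk0 : (k : ℂ) ≠ 0 := by exact_mod_cast (by omega : k ≠ 0)
    push_cast
    rw [pow_mul, mul_pow]
    field_simp

theorem Li_two_distribution (hx : ‖x‖ = 1) {p : ℕ} (hp : 0 < p) {w : ℂ}
    (hw : IsPrimitiveRoot w p) :
    (p : ℂ) * ∑ i ∈ range p, Li [(2, x * w ^ i)] = Li [(2, x ^ p)] := by
  have hp0 : (p : ℂ) ≠ 0 := by exact_mod_cast hp.ne'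
  have hw1 : ‖w‖ = 1 := hw.norm'_eq_one hp.ne'
  have h1 : Tendsto (fun m => p * m + 1) atTop atTop :=
    tendsto_atTop_mono (fun m => (Nat.le_mul_of_pos_left m hp).trans (Nat.le_succ _)) tendsto_id
  have hL := (tendsto_finsetSum (range p) fun i _ =>
    (tendsto_Li_two (x := x * w ^ i) (by simp [hx, hw1])).comp h1).const_mul (p : ℂ)
  refine tendsto_nhds_unique hL (((tendsto_Li_two (x := x ^ p) (by simp [hx])).comp
    (tendsto_add_atTop_nat 1)).congr fun m => ?_)
  have h := mpvPartial_distribution hp hw 2 x m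
  apply mul_left_cancel₀ hp0
  simp only [Function.comp_apply]
  linear_combination -h

theorem Li_one_distribution (hx : ‖x‖ = 1) {p : ℕ} (hp : 0 < p) (hxp : x ^ p ≠ 1) {w : ℂ}
    (hw : IsPrimitiveRoot w p) :
    ∑ i ∈ range p, Li [(1, x * w ^ i)] = Li [(1, x ^ p)] := by
  have hp0 : (p : ℂ) ≠ 0 := by exact_mod_cast hp.ne'
  have hw1 : ‖w‖ = 1 := hw.norm'_eq_one hp.ne'
  have h1 : Tendsto (fun m => p * m + 1) atTop atTop :=
    tendsto_atTop_mono (fun m => (Nat.le_mul_of_pos_left m hp).trans (Nat.le_succ _)) tendsto_id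
  have hne : ∀ i, x * w ^ i ≠ 1 := fun i h => hxp <| by
    have hp1 := congrArg (· ^ p) h
    simpa [mul_pow, ← pow_mul, mul_comm i, pow_mul w p i, hw.pow_eq_one] using hp1
  have hL := tendsto_finsetSum (range p) fun i _ =>
    (tendsto_Li_one (x := x * w ^ i) (by simp [hx, hw1]) (hne i)).comp h1
  refine tendsto_nhds_unique hL (((tendsto_Li_one (x := x ^ p) (by simp [hx]) hxp).comp
    (tendsto_add_atTop_nat 1)).congr fun m => ?_)
  have h := mpvPartial_distribution hp hw 1 x m
  apply mul_left_cancel₀ hp0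
  simp only [Function.comp_apply]
  linear_combination -h

theorem Li_one_sub_Li_one_inv {N : ℕ} (hN : N ≠ 0) (hx : x ^ N = 1) (hx1 : x ≠ 1) :
    ∃ q : ℚ, Li [(1, x)] - Li [(1, x⁻¹)] = q • (Real.pi * Complex.I : ℂ) := by
  have hx0 : x ≠ 0 := by rintro rfl; simp [hN] at hx
  have hn : ‖x‖ = 1 := Complex.norm_eq_one_of_pow_eq_one hx hN
  have hs : 1 - x ≠ 0 := sub_ne_zero.2 hx1.symm
  have hN0 : (N : ℂ) ≠ 0 := by exact_mod_cast hN
  have h : Complex.exp (((2 * N : ℕ) : ℂ) * (Li [(1, x)] - Li [(1, x⁻¹)])) = 1 := by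
    rw [Complex.exp_nat_mul, Complex.exp_sub, exp_Li_one hn hx1,
      exp_Li_one (by simp [hn]) (by simpa using hx1)]
    have : (1 - x)⁻¹ / (1 - x⁻¹)⁻¹ = -x⁻¹ := by
      have : (1 - x⁻¹) = -(1 - x) * x⁻¹ := by field_simp; ring
      rw [this]
      field_simp
    rw [this, pow_mul, neg_sq, ← pow_mul, mul_comm, pow_mul, inv_pow, hx]
    simp
  obtain ⟨n, hn⟩ := Complex.exp_eq_one_iff.1 h
  refine ⟨n / N, ?_⟩
  rw [Rat.smul_def]
  push_cast at hn ⊢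
  rw [div_mul_eq_mul_div, eq_div_iff hN0]
  linear_combination hn / 2

theorem Li_two_add_Li_two_inv {N : ℕ} (hN : N ≠ 0) (hx : x ^ N = 1) :
    ∃ q : ℚ, Li [(2, x)] + Li [(2, x⁻¹)] =
      q • ((Real.pi * Complex.I) * (Real.pi * Complex.I) : ℂ) := by
  have hn : ‖x‖ = 1 := Complex.norm_eq_one_of_pow_eq_one hx hN
  have : NeZero N := ⟨hN⟩
  obtain ⟨i, hi, rfl⟩ := (Complex.isPrimitiveRoot_exp N hN).eq_pow_of_pow_eq_one hx
  have hN0 : (0 : ℝ) < N := by exact_mod_cast Nat.pos_of_ne_zero hN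
  have hmem : (i / N : ℝ) ∈ Set.Icc (0 : ℝ) 1 :=
    ⟨by positivity, by rw [div_le_one hN0]; exact_mod_cast hi.le⟩
  have hF := hasSum_one_div_nat_pow_mul_cos one_ne_zero hmem
  set z := Complex.exp (2 * Real.pi * Complex.I / N) ^ i with hz
  have hz' : z = Complex.exp (2 * Real.pi * Complex.I * (i / N)) := by
    rw [hz, ← Complex.exp_nat_mul]
    congr 1
    ring
  set q : ℚ := (Polynomial.bernoulli 2).eval ((i : ℚ) / N) with hq
  have hB : (Polynomial.map (algebraMap ℚ ℝ) (Polynomial.bernoulli (2 * 1))).eval (i / N : ℝ) =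
      (q : ℝ) := by
    have : (i / N : ℝ) = algebraMap ℚ ℝ ((i : ℚ) / N) := by simp
    rw [this, Polynomial.eval_map_apply]
    rfl
  refine ⟨-2 * q, ?_⟩
  have hc := (Complex.hasSum_ofReal.2 hF).tendsto_sum_nat
  have hl := ((tendsto_Li_two hn).add (tendsto_Li_two (x := z⁻¹) (by simp [hn])))
  have hu := tendsto_nhds_unique hl ((hc.const_mul 2).congr' ?_)
  · rw [hu, hB, Rat.smul_def]
    push_cast
    norm_num [Nat.factorial]
    ring_nf
    rw [Complex.I_sq]
    ring
  · filter_upwards [eventually_ge_atTop 1] with m hm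
    rw [mpvPartial_singleton, mpvPartial_singleton, range_eq_Ico, sum_eq_sum_Ico_succ_bot hm,
      ← sum_add_distrib]
    simp only [CharP.cast_eq_zero]
    norm_num
    rw [mul_sum]
    refine sum_congr rfl fun k _ => ?_
    rw [Complex.cos, hz', ← Complex.exp_nat_mul, ← Complex.exp_neg]
    ring_nf

end Values

section LevelTwentyFive

/-- Representatives, modulo sign, of the residues prime to `5`. -/
abbrev UnitResidue := {a : ZMod 25 // 0 < a.val ∧ a.val ≤ 12 ∧ ¬ 5 ∣ a.val}

/-- The pairs `(a, b)` which extend to an increasing triple of positive integers with sum `25`. -/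
def IsSorted (a b : ZMod 25) : Prop := 0 < a.val ∧ a.val < b.val ∧ a.val + 2 * b.val < 25

instance (a b : ZMod 25) : Decidable (IsSorted a b) := by unfold IsSorted; infer_instance

/-- Representatives of the free orbits of the dihedral group of order `12` on `(ℤ/25)²`. -/
abbrev SortedPair := {p : ZMod 25 × ZMod 25 // IsSorted p.1 p.2}

/-- Some permutation of the triple `(a, b, -a - b)` is sorted. -/
def IsSortable (a b : ZMod 25) : Prop :=
  (IsSorted a b ∨ IsSorted b a) ∨ (IsSorted a (-a - b) ∨ IsSorted (-a - b) a) ∨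
    (IsSorted b (-a - b) ∨ IsSorted (-a - b) b)

instance (a b : ZMod 25) : Decidable (IsSortable a b) := by
  unfold IsSortable; infer_instance

theorem card_unitResidue : Fintype.card UnitResidue = 10 := by decide +kernel

theorem card_sortedPair : Fintype.card SortedPair = 40 := by decide +kernel

theorem isSortable_or_neg : ∀ a b : ZMod 25, a ≠ 0 → b ≠ 0 → a + b ≠ 0 →
    (a = b ∨ b = -a - b ∨ a = -a - b) ∨ IsSortable a b ∨ IsSortable (-a) (-b) := by
  decide +kernel

/-- The root of unity `exp (2πi a / 25)`. -/
noncomputable def zeta (a : ZMod 25) : ℂ := ZMod.stdAddChar a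

theorem zeta_add (a b : ZMod 25) : zeta (a + b) = zeta a * zeta b := AddChar.map_add_eq_mul _ _ _

theorem zeta_zero : zeta 0 = 1 := AddChar.map_zero_eq_one _

theorem zeta_neg (a : ZMod 25) : zeta (-a) = (zeta a)⁻¹ := AddChar.map_neg_eq_inv _ _

theorem zeta_sub (a b : ZMod 25) : zeta (a - b) = zeta a / zeta b := AddChar.map_sub_eq_div _ _ _

theorem zeta_mul_natCast (a : ZMod 25) (n : ℕ) : zeta (n * a) = zeta a ^ n := by
  rw [← nsmul_eq_mul]
  exact AddChar.map_nsmul_eq_pow _ _ _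

theorem zeta_injective : Function.Injective zeta := ZMod.injective_stdAddChar

theorem zeta_ne_one {a : ZMod 25} (ha : a ≠ 0) : zeta a ≠ 1 := fun h =>
  ha (zeta_injective (h.trans zeta_zero.symm))

theorem zeta_pow (a : ZMod 25) : zeta a ^ 25 = 1 := by
  rw [← zeta_mul_natCast, ← zeta_zero]
  congr 1
  exact (by decide : ∀ a : ZMod 25, ((25 : ℕ) : ZMod 25) * a = 0) a

theorem norm_zeta (a : ZMod 25) : ‖zeta a‖ = 1 :=
  Complex.norm_eq_one_of_pow_eq_one (zeta_pow a) (by norm_num)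

theorem isPrimitiveRoot_zeta_five : IsPrimitiveRoot (zeta 5) 5 := by
  have h : orderOf (zeta 5) = 5 := by
    have : Fact (Nat.Prime 5) := ⟨by norm_num⟩
    refine orderOf_eq_prime ?_ (zeta_ne_one (by decide))
    rw [← zeta_mul_natCast, ← zeta_zero]
    rfl
  simpa [h] using IsPrimitiveRoot.orderOf (zeta 5)

theorem exists_zeta_eq {x : ℂ} (hx : x ^ 25 = 1) : ∃ a, x = zeta a := by
  have h1 : IsPrimitiveRoot (zeta 1) 25 := by
    refine IsPrimitiveRoot.mk_of_lt _ (by norm_num) (zeta_pow 1) fun l hl hl' h => ?_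
    rw [← zeta_mul_natCast, mul_one] at h
    refine zeta_ne_one (fun h0 => ?_) h
    rw [ZMod.natCast_eq_zero_iff] at h0
    exact absurd (Nat.le_of_dvd hl h0) (by omega)
  obtain ⟨i, -, rfl⟩ := h1.eq_pow_of_pow_eq_one hx
  exact ⟨i * 1, (zeta_mul_natCast 1 i).symm⟩

theorem Li_distribution_exponent (s : ℕ) (a : ZMod 25) :
    ∑ i ∈ range 5, Li [(s, zeta a * zeta 5 ^ i)] =
      ∑ i ∈ range 5, Li [(s, zeta (a + i * 5))] :=
  sum_congr rfl fun i _ => by rw [zeta_add, zeta_mul_natCast]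

theorem zeta_five_mul (a : ZMod 25) : zeta (5 * a) = zeta a ^ 5 := by
  exact_mod_cast zeta_mul_natCast a 5

/-- A subspace closed under inversion and distribution relations contains all values at nontrivial
25th roots of unity once it contains those at the representatives. -/
theorem mem_of_neg_of_distribution {V : Submodule ℚ ℂ} {f : ZMod 25 → ℂ}
    (hf : ∀ a : UnitResidue, f a ∈ V) (hneg : ∀ a ≠ 0, f a ∈ V → f (-a) ∈ V)
    (hdist : ∀ a, 5 * a ≠ 0 → (∀ i ∈ range 5, f (a + i * 5) ∈ V) → f (5 * a) ∈ V)
    {a : ZMod 25} (ha : a ≠ 0) : f a ∈ V := by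
  have key : ∀ a : ZMod 25, ¬ 5 ∣ a.val → f a ∈ V := by
    intro a ha
    rcases (by decide +kernel : ∀ a : ZMod 25, ¬ 5 ∣ a.val →
      (0 < a.val ∧ a.val ≤ 12 ∧ ¬ 5 ∣ a.val) ∨
        (-a ≠ 0 ∧ 0 < (-a).val ∧ (-a).val ≤ 12 ∧ ¬ 5 ∣ (-a).val)) a ha with h | ⟨h0, h⟩
    · exact hf ⟨a, h⟩
    · simpa using hneg (-a) h0 (hf ⟨-a, h⟩)
  by_cases h5 : 5 ∣ a.val
  · obtain ⟨c, rfl, hc⟩ := (by decide +kernel : ∀ a : ZMod 25, a ≠ 0 → 5 ∣ a.val →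
      ∃ c : ZMod 25, a = 5 * c ∧ ∀ i ∈ range 5, ¬ 5 ∣ (c + i * 5).val) a ha h5
    exact hdist c ha fun i hi => key _ (hc i hi)
  · exact key a h5

/-- Generators of the weight one values. -/
noncomputable def weightOneGen : Option UnitResidue → ℂ
  | none => Real.pi * Complex.I
  | some a => Li [(1, zeta a)]

/-- Generators of the weight two values: products in weight one, dilogarithms and double
logarithms. -/
noncomputable def weightTwoGen : Sym2 (Option UnitResidue) ⊕ UnitResidue ⊕ SortedPair → ℂ :=
  Sum.elim (Sym2.lift ⟨fun i j => weightOneGen i * weightOneGen j, fun _ _ => mul_comm _ _⟩)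
    (Sum.elim (fun a => Li [(2, zeta a)]) fun p => Li [(1, zeta p.1.1), (1, zeta p.1.2)])

theorem Li_one_mem {a : ZMod 25} (ha : a ≠ 0) :
    Li [(1, zeta a)] ∈ Submodule.span ℚ (Set.range weightOneGen) := by
  refine mem_of_neg_of_distribution (f := fun a => Li [(1, zeta a)])
    (fun a => Submodule.subset_span (Set.mem_range_self (f := weightOneGen) (some a)))
    (fun a ha h => ?_) (fun a ha h => ?_) ha
  · obtain ⟨q, hq⟩ := Li_one_sub_Li_one_inv (by norm_num) (zeta_pow a) (zeta_ne_one ha)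
    rw [← zeta_neg] at hq
    rw [← sub_sub_cancel (Li [(1, zeta a)]) (Li [(1, zeta (-a))]), hq]
    exact sub_mem h (Submodule.smul_mem _ q (Submodule.subset_span ⟨none, rfl⟩))
  · have hp := zeta_ne_one ha
    rw [zeta_five_mul] at hp ⊢
    rw [← Li_one_distribution (norm_zeta a) (by norm_num) hp isPrimitiveRoot_zeta_five,
      Li_distribution_exponent]
    exact sum_mem h

theorem mul_mem_weightTwo {u v : ℂ} (hu : u ∈ Submodule.span ℚ (Set.range weightOneGen))
    (hv : v ∈ Submodule.span ℚ (Set.range weightOneGen)) :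
    u * v ∈ Submodule.span ℚ (Set.range weightTwoGen) := by
  have h := Submodule.mul_mem_mul hu hv
  rw [Submodule.span_mul_span] at h
  refine Submodule.span_mono ?_ h
  rintro _ ⟨_, ⟨i, rfl⟩, _, ⟨j, rfl⟩, rfl⟩
  exact ⟨Sum.inl s(i, j), rfl⟩

theorem Li_one_mul_Li_one_mem {a b : ZMod 25} (ha : a ≠ 0) (hb : b ≠ 0) :
    Li [(1, zeta a)] * Li [(1, zeta b)] ∈ Submodule.span ℚ (Set.range weightTwoGen) :=
  mul_mem_weightTwo (Li_one_mem ha) (Li_one_mem hb)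

theorem Li_two_add_neg_mem (a : ZMod 25) :
    Li [(2, zeta a)] + Li [(2, zeta (-a))] ∈ Submodule.span ℚ (Set.range weightTwoGen) := by
  obtain ⟨q, hq⟩ := Li_two_add_Li_two_inv (by norm_num) (zeta_pow a)
  rw [zeta_neg, hq]
  exact Submodule.smul_mem _ q (mul_mem_weightTwo (Submodule.subset_span ⟨none, rfl⟩)
    (Submodule.subset_span ⟨none, rfl⟩))

theorem mem_of_two_mul_mem {V : Submodule ℚ ℂ} {z : ℂ} (h : z + z ∈ V) : z ∈ V := by
  have h2 := V.smul_mem (1 / 2 : ℚ) h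
  rwa [← two_smul ℚ z, smul_smul, one_div, inv_mul_cancel₀ two_ne_zero, one_smul] at h2

theorem Li_two_mem (a : ZMod 25) :
    Li [(2, zeta a)] ∈ Submodule.span ℚ (Set.range weightTwoGen) := by
  by_cases ha : a = 0
  · subst ha
    exact mem_of_two_mul_mem (by simpa using Li_two_add_neg_mem 0)
  refine mem_of_neg_of_distribution (f := fun a => Li [(2, zeta a)])
    (fun a =>
      Submodule.subset_span (Set.mem_range_self (f := weightTwoGen) (Sum.inr (Sum.inl a))))
    (fun a _ h => ?_) (fun a _ h => ?_) ha
  · exact (Submodule.add_mem_iff_right _ h).1 (Li_two_add_neg_mem a)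
  · rw [zeta_five_mul, ← Li_two_distribution (norm_zeta a) (by norm_num) isPrimitiveRoot_zeta_five,
      Li_distribution_exponent, ← nsmul_eq_mul]
    exact nsmul_mem (sum_mem h) 5

/-- The double logarithm at exponents `(a, b)` lies in the span of the generators. -/
def DoubleLogMem (a b : ZMod 25) : Prop :=
  Li [(1, zeta a), (1, zeta b)] ∈ Submodule.span ℚ (Set.range weightTwoGen)

theorem stuffle_mem {a b : ZMod 25} (ha : a ≠ 0) (hb : b ≠ 0) :
    Li [(1, zeta a), (1, zeta b)] + Li [(1, zeta b), (1, zeta a)] ∈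
      Submodule.span ℚ (Set.range weightTwoGen) := by
  have h := Li_stuffle (norm_zeta a) (zeta_ne_one ha) (norm_zeta b) (zeta_ne_one hb)
  rw [← zeta_add] at h
  rw [← Submodule.add_mem_iff_left _ (Li_two_mem (a + b)), h]
  exact Li_one_mul_Li_one_mem ha hb

theorem shuffle_mem {a b : ZMod 25} (ha : a ≠ 0) (hb : b ≠ 0) :
    Li [(1, zeta a), (1, zeta (b - a))] + Li [(1, zeta b), (1, zeta (a - b))] ∈
      Submodule.span ℚ (Set.range weightTwoGen) := by
  rw [zeta_sub, zeta_sub,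
    Li_shuffle (norm_zeta a) (zeta_ne_one ha) (norm_zeta b) (zeta_ne_one hb)]
  exact Li_one_mul_Li_one_mem ha hb

namespace DoubleLogMem

variable {a b : ZMod 25}

theorem swap (ha : a ≠ 0) (hb : b ≠ 0) (h : DoubleLogMem a b) : DoubleLogMem b a :=
  (Submodule.add_mem_iff_right _ h).1 (stuffle_mem ha hb)

theorem reflect (ha : a ≠ 0) (hab : a + b ≠ 0) (h : DoubleLogMem a b) :
    DoubleLogMem (a + b) (-b) := by
  have hs := shuffle_mem ha hab
  rw [add_sub_cancel_left, sub_add_cancel_left] at hs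
  exact (Submodule.add_mem_iff_right _ h).1 hs

theorem zero_right (ha : a ≠ 0) : DoubleLogMem a 0 :=
  mem_of_two_mul_mem (by simpa using shuffle_mem ha ha)

theorem diag (ha : a ≠ 0) : DoubleLogMem a a :=
  mem_of_two_mul_mem (stuffle_mem ha ha)

theorem neg_right (ha : a ≠ 0) : DoubleLogMem a (-a) := by
  unfold DoubleLogMem
  rw [zeta_neg, Li_one_one_inv (norm_zeta a) (zeta_ne_one ha), ← zeta_zero]
  exact add_mem (zero_right ha) (Li_two_mem a)

theorem of_isSorted (h : IsSorted a b) : DoubleLogMem a b :=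
  Submodule.subset_span ⟨Sum.inr (Sum.inr ⟨(a, b), h⟩), rfl⟩

theorem neg (ha : a ≠ 0) (hb : b ≠ 0) (hab : a + b ≠ 0) (h : DoubleLogMem a b) :
    DoubleLogMem (-a) (-b) := by
  have h1 := (h.reflect ha hab).swap hab (neg_ne_zero.2 hb)
  have h2 := h1.reflect (neg_ne_zero.2 hb) (by simpa using ha)
  rw [neg_add_cancel_comm_assoc] at h2
  have h3 := (h2.swap ha (neg_ne_zero.2 hab)).reflect (neg_ne_zero.2 hab) (by simpa using hb)
  have e : -(a + b) + a = -b := by ring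
  rw [e] at h3
  exact h3.swap (neg_ne_zero.2 hb) (neg_ne_zero.2 ha)

theorem rotate (ha : a ≠ 0) (hb : b ≠ 0) (hab : a + b ≠ 0) (h : DoubleLogMem a b) :
    DoubleLogMem b (-a - b) := by
  have h1 := (h.reflect ha hab).neg hab (neg_ne_zero.2 hb) (by simpa using ha)
  rw [neg_neg] at h1
  have h2 := h1.swap (neg_ne_zero.2 hab) hb
  rwa [neg_add'] at h2

theorem of_rotate_rotate (ha : a ≠ 0) (hb : b ≠ 0) (hab : a + b ≠ 0)
    (h : DoubleLogMem (-a - b) a) : DoubleLogMem a b := by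
  have e : -a - b + a = -b := by ring
  have h1 := h.rotate (by rwa [← neg_add', neg_ne_zero]) ha (by rwa [e, neg_ne_zero])
  have e' : -(-a - b) - a = b := by ring
  rwa [e'] at h1

theorem of_rotate (ha : a ≠ 0) (hb : b ≠ 0) (hab : a + b ≠ 0)
    (h : DoubleLogMem b (-a - b)) : DoubleLogMem a b := by
  have e : b + (-a - b) = -a := by ring
  have h1 := h.rotate hb (by rwa [← neg_add', neg_ne_zero]) (by rwa [e, neg_ne_zero])
  have e' : -b - (-a - b) = a := by ring
  rw [e'] at h1
  exact of_rotate_rotate ha hb hab h1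

theorem of_isSortable (ha : a ≠ 0) (hb : b ≠ 0) (hab : a + b ≠ 0)
    (h : IsSortable a b) : DoubleLogMem a b := by
  have hc : -a - b ≠ 0 := by rwa [← neg_add', neg_ne_zero]
  rcases h with (h | h) | (h | h) | (h | h)
  · exact of_isSorted h
  · exact (of_isSorted h).swap hb ha
  · exact of_rotate_rotate ha hb hab ((of_isSorted h).swap ha hc)
  · exact of_rotate_rotate ha hb hab (of_isSorted h)
  · exact of_rotate ha hb hab (of_isSorted h)
  · exact of_rotate ha hb hab ((of_isSorted h).swap hc hb)

end DoubleLogMem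

theorem doubleLogMem {a : ZMod 25} (ha : a ≠ 0) (b : ZMod 25) : DoubleLogMem a b := by
  by_cases hb : b = 0
  · exact hb ▸ .zero_right ha
  by_cases hab : a + b = 0
  · rw [eq_neg_of_add_eq_zero_right hab]
    exact .neg_right ha
  rcases isSortable_or_neg a b ha hb hab with (h | h | h) | h | h
  · exact h ▸ .diag ha
  · exact .of_rotate ha hb hab (h ▸ .diag hb)
  · exact .of_rotate_rotate ha hb hab (h ▸ .diag ha)
  · exact .of_isSortable ha hb hab h
  · have h1 := DoubleLogMem.of_isSortable (neg_ne_zero.2 ha) (neg_ne_zero.2 hb)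
      (by rwa [← neg_add, neg_ne_zero]) h
    simpa using h1.neg (neg_ne_zero.2 ha) (neg_ne_zero.2 hb) (by rwa [← neg_add, neg_ne_zero])

theorem MPV_two_le : MPV 2 25 ≤ Submodule.span ℚ (Set.range weightTwoGen) := by
  refine Submodule.span_le.2 ?_
  rintro _ ⟨l, hl, hw, hh, rfl⟩
  match l, hl, hw, hh with
  | [], _, hw, _ => simp at hw
  | [(s, x)], hl, hw, _ =>
    obtain rfl : s = 2 := by simpa using hw
    obtain ⟨a, rfl⟩ := exists_zeta_eq (hl _ List.mem_cons_self).2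
    exact Li_two_mem a
  | [(s, x), (t, y)], hl, hw, hh =>
    simp only [List.forall_mem_cons, List.map_cons, List.map_nil, List.sum_cons, List.sum_nil,
      List.head?_cons] at hl hw hh
    obtain ⟨⟨hs, hx⟩, ⟨ht, hy⟩, -⟩ := hl
    obtain rfl : s = 1 := by omega
    obtain rfl : t = 1 := by omega
    obtain ⟨a, rfl⟩ := exists_zeta_eq hx
    obtain ⟨b, rfl⟩ := exists_zeta_eq hy
    exact doubleLogMem (fun ha => hh (by rw [ha, zeta_zero])) b
  | (s, x) :: (t, y) :: (u, z) :: r, hl, hw, _ =>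
    simp only [List.forall_mem_cons, List.map_cons, List.sum_cons] at hl hw
    omega

end LevelTwentyFive

/-- the `ℚ`-vector space spanned by all multiple polylogarithm
values of weight 2 at 25th roots of unity has dimension at most 116,
i.e. `d(2,25) ≤ 116`. -/
theorem mpv_dim_weight2_level25 :
    Module.rank ℚ ↥(MPV 2 25) ≤ 116 := by
  refine (Submodule.rank_mono MPV_two_le).trans
    ((rank_span_le _).trans (Cardinal.mk_range_le.trans ?_))
  rw [Cardinal.mk_fintype, Fintype.card_sum, Fintype.card_sum, Sym2.card, Fintype.card_option,
    card_unitResidue, card_sortedPair]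
  norm_num [Nat.choose]
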